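/- Let Ω ⊂ ℝⁿ be an open bounded domain satisfying the uniform exterior sphere condition, assume the standing assumptions, and let g ∈ C(∂Ω). Then there exist w̲, w̄ ∈ C(Ω̄) with w̲ = g and w̄ = g on ∂Ω such that for every ε ∈ (0,1) and every v ∈ C(Ω̄), w̄ is a viscosity supersolution and w̲ is a viscosity subsolution of the regularized equation G_ε(x, Du)(ε u + F(D²u)) = f(x) in Ω. -/

import Mathlib

open Metric Set MeasureTheory Topology

noncomputable section

abbrev En (n : ℕ) : Type := EuclideanSpace ℝ (Fin n)
abbrev Mat (n : ℕ) : Type := Matrix (Fin n) (Fin n) ℝ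

/-- `F : 𝒮(n) → ℝ` is uniformly `(λ,Λ)`-elliptic:
for all symmetric `A, B` with `B` positive semidefinite,
`λ·tr B ≤ F A − F (A + B) ≤ Λ·tr B`. -/
def UniformlyElliptic {n : ℕ} (lam Lam : ℝ) (F : Mat n → ℝ) : Prop :=
  Continuous F ∧
    ∀ A B : Mat n, A.IsSymm → B.IsSymm → B.PosSemidef →
      lam * B.trace ≤ F A - F (A + B) ∧ F A - F (A + B) ≤ Lam * B.trace

/-- The Hessian matrix of `φ` at `x`, in the standard basis of `ℝⁿ`. -/
def hessianMatrix {n : ℕ} (φ : En n → ℝ) (x : En n) : Mat n :=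
  Matrix.of fun i j =>
    iteratedFDeriv ℝ 2 φ x ![EuclideanSpace.single i (1 : ℝ), EuclideanSpace.single j (1 : ℝ)]

/-- `w` is a viscosity subsolution of `G(x, u(x), Du, D²u) = 0` on `Ω`:
whenever a `C²` function `φ` is such that `w − φ` has a local maximum (on `Ω`) at `x₀ ∈ Ω`,
then `G x₀ (w x₀) (Dφ x₀) (D²φ x₀) ≤ 0`. -/
def ViscSubOn {n : ℕ} (Ω : Set (En n)) (G : En n → ℝ → En n → Mat n → ℝ)
    (w : En n → ℝ) : Prop :=
  ∀ φ : En n → ℝ, ContDiff ℝ 2 φ → ∀ x₀ ∈ Ω,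
    IsLocalMaxOn (fun x => w x - φ x) Ω x₀ →
      G x₀ (w x₀) (gradient φ x₀) (hessianMatrix φ x₀) ≤ 0

/-- `w` is a viscosity supersolution of `G(x, u(x), Du, D²u) = 0` on `Ω`. -/
def ViscSupOn {n : ℕ} (Ω : Set (En n)) (G : En n → ℝ → En n → Mat n → ℝ)
    (w : En n → ℝ) : Prop :=
  ∀ φ : En n → ℝ, ContDiff ℝ 2 φ → ∀ x₀ ∈ Ω,
    IsLocalMinOn (fun x => w x - φ x) Ω x₀ →
      0 ≤ G x₀ (w x₀) (gradient φ x₀) (hessianMatrix φ x₀)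

/-- viscosity solution: both a subsolution and a supersolution. -/
def ViscSolOn {n : ℕ} (Ω : Set (En n)) (G : En n → ℝ → En n → Mat n → ℝ)
    (u : En n → ℝ) : Prop :=
  ViscSubOn Ω G u ∧ ViscSupOn Ω G u

/-- `H(x, z; ξ) = |ξ+z|^p + coef(x)·|ξ+z|^e`. -/
def Hfun {n : ℕ} (p e : ℝ) (coef : En n → ℝ) (ξ x z : En n) : ℝ :=
  ‖ξ + z‖ ^ p + coef x * ‖ξ + z‖ ^ e

/-- The switched exponent `p_v(x) = p⁺·1_{v>0}(x) + p⁻·1_{v<0}(x)`. -/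
def pSwitch {n : ℕ} (pp pm : ℝ) (v : En n → ℝ) (x : En n) : ℝ :=
  pp * Set.indicator {y | 0 < v y} (fun _ => (1 : ℝ)) x
    + pm * Set.indicator {y | v y < 0} (fun _ => (1 : ℝ)) x

/-- The transmission operator
`[|ξ+z|^{p_v(x)} + a(x)1_{v>0}|ξ+z|^q + b(x)1_{v<0}|ξ+z|^s]·F(X) − f(x)`. -/
def transOp {n : ℕ} (F : Mat n → ℝ) (pp pm q s : ℝ) (a b f v : En n → ℝ) (ξ : En n) :
    En n → ℝ → En n → Mat n → ℝ :=
  fun x _ z X =>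
    (‖ξ + z‖ ^ pSwitch pp pm v x
        + a x * Set.indicator {y | 0 < v y} (fun _ => (1 : ℝ)) x * ‖ξ + z‖ ^ q
        + b x * Set.indicator {y | v y < 0} (fun _ => (1 : ℝ)) x * ‖ξ + z‖ ^ s) * F X - f x

/-- `min{F(X), H_q(x,z;ξ)F(X), H_s(x,z;ξ)F(X)} − rhs(x)`. -/
def minOp {n : ℕ} (F : Mat n → ℝ) (pp pm q s : ℝ) (a b : En n → ℝ) (ξ : En n)
    (rhs : En n → ℝ) : En n → ℝ → En n → Mat n → ℝ :=
  fun x _ z X =>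
    min (F X) (min (Hfun pp q a ξ x z * F X) (Hfun pm s b ξ x z * F X)) - rhs x

/-- `max{F(X), H_q(x,z;ξ)F(X), H_s(x,z;ξ)F(X)} − rhs(x)`. -/
def maxOp {n : ℕ} (F : Mat n → ℝ) (pp pm q s : ℝ) (a b : En n → ℝ) (ξ : En n)
    (rhs : En n → ℝ) : En n → ℝ → En n → Mat n → ℝ :=
  fun x _ z X =>
    max (F X) (max (Hfun pp q a ξ x z * F X) (Hfun pm s b ξ x z * F X)) - rhs x

/-- Definition D: `u` is a viscosity solution of the free transmission equation
relative to the sign of `v`, with translation vector `ξ`. -/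
def DefDSolution {n : ℕ} (Ω : Set (En n)) (F : Mat n → ℝ) (pp pm q s : ℝ)
    (a b f : En n → ℝ) (v : En n → ℝ) (ξ : En n) (u : En n → ℝ) : Prop :=
  ViscSolOn ({x ∈ Ω | 0 < v x} ∪ {x ∈ Ω | v x < 0}) (transOp F pp pm q s a b f v ξ) u ∧
  ViscSubOn {x ∈ Ω | v x = 0} (minOp F pp pm q s a b ξ f) u ∧
  ViscSupOn {x ∈ Ω | v x = 0} (maxOp F pp pm q s a b ξ f) u

/-- Uniform exterior sphere condition for `Ω`. -/
def UnifExtSphere {n : ℕ} (Ω : Set (En n)) : Prop :=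
  ∃ r : ℝ, 0 < r ∧ ∀ y ∈ frontier Ω, ∃ x : En n,
    dist y x = r ∧ Metric.closedBall x r ∩ closure Ω = {y}

/-- `φ` is a smooth, nonnegative, radially symmetric mollifier supported in `B_ε(0)`
with unit mass. -/
def IsMollifier {n : ℕ} (ε : ℝ) (φ : En n → ℝ) : Prop :=
  ContDiff ℝ (⊤ : ℕ∞) φ ∧ (∀ x, 0 ≤ φ x) ∧ (∀ x y : En n, ‖x‖ = ‖y‖ → φ x = φ y) ∧
    (∫ x, φ x) = 1 ∧ ∀ x : En n, ε ≤ ‖x‖ → φ x = 0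

/-- The mollified indicator `(φε * 1_S)(x)`. -/
def smoothedChi {n : ℕ} (φε : En n → ℝ) (S : Set (En n)) (x : En n) : ℝ :=
  ∫ y, φε y * S.indicator (fun _ => (1 : ℝ)) (x - y)

/-- `ℓ_μ(z) = √(μ² + |z|²)`. -/
def ellReg {n : ℕ} (μ : ℝ) (z : En n) : ℝ := Real.sqrt (μ ^ 2 + ‖z‖ ^ 2)

/-- The regularized operator
`G_ε(x, z)·(ε·r + F(X)) − f(x)`, where
`G_ε(x,z) = ℓ_ε(z)^{p_{ε;v}(x)} + a_{ε;v}(x) ℓ_ε(z)^q + b_{ε;v}(x) ℓ_ε(z)^s`. -/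
def regOp {n : ℕ} (F : Mat n → ℝ) (ε pp pm q s : ℝ) (a b v f φε : En n → ℝ) :
    En n → ℝ → En n → Mat n → ℝ :=
  fun x r z X =>
    (ellReg ε z ^ (ε + pp * smoothedChi φε {y | 0 < v y} x + pm * smoothedChi φε {y | v y < 0} x)
        + (ε + a x * smoothedChi φε {y | 0 < v y} x) * ellReg ε z ^ q
        + (ε + b x * smoothedChi φε {y | v y < 0} x) * ellReg ε z ^ s) * (ε * r + F X) - f x

/-- The Multi-Phase operator with variable exponents:
`[ℓ_μ(z)^{p(x)} + a(x)ℓ_μ(z)^{q(x)} + b(x)ℓ_μ(z)^{s(x)}]·(μ·r + F(X)) − f(x)`. -/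
def mpOp {n : ℕ} (F : Mat n → ℝ) (μ : ℝ) (p q s a b f : En n → ℝ) :
    En n → ℝ → En n → Mat n → ℝ :=
  fun x r z X =>
    (ellReg μ z ^ p x + a x * ellReg μ z ^ q x + b x * ellReg μ z ^ s x) * (μ * r + F X) - f x

/-- Pucci maximal operator `M⁺_{λ,Λ}(A) = −Λ·tr(A⁻) − λ·tr(A⁺)`. -/
def pucciPlus {n : ℕ} (lam Lam : ℝ) (A : Mat n) : ℝ :=
  if h : A.IsHermitian then
    -(Lam * ∑ i, min (h.eigenvalues i) 0) - lam * ∑ i, max (h.eigenvalues i) 0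
  else 0

/-- Pucci minimal operator `M⁻_{λ,Λ}(A) = −Λ·tr(A⁺) − λ·tr(A⁻)`. -/
def pucciMinus {n : ℕ} (lam Lam : ℝ) (A : Mat n) : ℝ :=
  if h : A.IsHermitian then
    -(Lam * ∑ i, max (h.eigenvalues i) 0) - lam * ∑ i, min (h.eigenvalues i) 0
  else 0

/-- `u` is locally `β`-Hölder continuous on `Ω`. -/
def LocallyHolderOn {n : ℕ} (Ω : Set (En n)) (β : ℝ) (u : En n → ℝ) : Prop :=
  ∀ x ∈ Ω, ∃ ε > 0, ∃ C : ℝ, ∀ y ∈ ball x ε ∩ Ω, ∀ z ∈ ball x ε ∩ Ω,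
    |u y - u z| ≤ C * ‖y - z‖ ^ β

/-- `u ∈ C^{1,α}_loc(Ω)`: `u` is differentiable on `Ω` with locally
`α`-Hölder continuous gradient. -/
def C1HolderLocOn {n : ℕ} (Ω : Set (En n)) (α : ℝ) (u : En n → ℝ) : Prop :=
  (∀ x ∈ Ω, DifferentiableAt ℝ u x) ∧
  ∀ x ∈ Ω, ∃ ε > 0, ∃ C : ℝ, ∀ y ∈ ball x ε ∩ Ω, ∀ z ∈ ball x ε ∩ Ω,
    ‖gradient u y - gradient u z‖ ≤ C * ‖y - z‖ ^ α

lemma second_deriv_nonneg {h h' : ℝ → ℝ} {d : ℝ} (h1 : ∀ t, HasDerivAt h (h' t) t)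
    (h2 : HasDerivAt h' d 0) (hm : IsLocalMin h 0) : 0 ≤ d := by
  by_contra hd
  push Not at hd
  have e1 : deriv h = h' := funext fun t => (h1 t).deriv
  have e2 : deriv (deriv h) 0 = d := by rw [e1]; exact h2.deriv
  have hM : IsLocalMax h 0 :=
    isLocalMax_of_deriv_deriv_neg (by rw [e2]; exact hd) hm.deriv_eq_zero (h1 0).continuousAt
  have hc : h =ᶠ[𝓝 0] fun _ => h 0 := by
    filter_upwards [hm, hM] with t a b using le_antisymm b a
  have := hc.deriv.deriv_eq
  simp [e2] at this
  linarith

/-- The explicit barrier profile. -/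
def Wb {n : ℕ} (α : ℝ) (p : ℝ × ℝ × En n) (x : En n) : ℝ :=
  p.1 - p.2.1 * Real.exp (-α * ‖x - p.2.2‖ ^ 2)

lemma Wb_cont {n : ℕ} (α : ℝ) : Continuous fun z : En n × (ℝ × ℝ × En n) => Wb α z.2 z.1 := by
  unfold Wb; fun_prop

lemma Wb_cont1 {n : ℕ} (α : ℝ) (p : ℝ × ℝ × En n) : Continuous (Wb α p) := by
  unfold Wb; fun_prop

lemma Wb_cont2 {n : ℕ} (α : ℝ) (x : En n) : Continuous fun p : ℝ × ℝ × En n => Wb α p x := by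
  unfold Wb; fun_prop

/-- The coefficient `κ`. -/
def kap {n : ℕ} (α : ℝ) (p : ℝ × ℝ × En n) (x : En n) : ℝ :=
  2 * α * p.2.1 * Real.exp (-α * ‖x - p.2.2‖ ^ 2)

def dW {n : ℕ} (α : ℝ) (p : ℝ × ℝ × En n) (x ξ : En n) (t : ℝ) : ℝ :=
  p.2.1 * (Real.exp (-α * (‖x - p.2.2‖ ^ 2 + 2 * t * inner ℝ (x - p.2.2) ξ + t ^ 2 * ‖ξ‖ ^ 2)) *
    (α * (2 * inner ℝ (x - p.2.2) ξ + 2 * t * ‖ξ‖ ^ 2)))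

lemma Wb_line {n : ℕ} (α : ℝ) (p : ℝ × ℝ × En n) (x ξ : En n) (t : ℝ) :
    Wb α p (x + t • ξ) = p.1 - p.2.1 *
      Real.exp (-α * (‖x - p.2.2‖ ^ 2 + 2 * t * inner ℝ (x - p.2.2) ξ + t ^ 2 * ‖ξ‖ ^ 2)) := by
  unfold Wb
  have : x + t • ξ - p.2.2 = (x - p.2.2) + t • ξ := by abel
  rw [this, norm_add_sq_real, norm_smul, inner_smul_right, mul_pow, Real.norm_eq_abs, sq_abs]
  ring_nf

lemma Wb_d1 {n : ℕ} (α : ℝ) (p : ℝ × ℝ × En n) (x ξ : En n) (t : ℝ) :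
    HasDerivAt (fun t : ℝ => Wb α p (x + t • ξ)) (dW α p x ξ t) t := by
  simp_rw [Wb_line]
  have h1 : HasDerivAt (fun t : ℝ => -α * (‖x - p.2.2‖ ^ 2 + 2 * t * inner ℝ (x - p.2.2) ξ
      + t ^ 2 * ‖ξ‖ ^ 2)) (-α * (2 * inner ℝ (x - p.2.2) ξ + 2 * t * ‖ξ‖ ^ 2)) t := by
    have a := ((hasDerivAt_id t).const_mul 2).mul_const (inner ℝ (x - p.2.2) ξ)
    have b := ((hasDerivAt_id t).pow 2).mul_const (‖ξ‖ ^ 2)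
    have := ((a.const_add (‖x - p.2.2‖ ^ 2)).add b).const_mul (-α)
    simpa using this
  have := (h1.exp.const_mul p.2.1).const_sub p.1
  refine this.congr_deriv ?_
  unfold dW; ring

lemma Wb_d2 {n : ℕ} (α : ℝ) (p : ℝ × ℝ × En n) (x ξ : En n) :
    HasDerivAt (dW α p x ξ)
      (kap α p x * (‖ξ‖ ^ 2 - 2 * α * (inner ℝ (x - p.2.2) ξ) ^ 2)) 0 := by
  have h1 : HasDerivAt (fun t : ℝ => -α * (‖x - p.2.2‖ ^ 2 + 2 * t * inner ℝ (x - p.2.2) ξ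
      + t ^ 2 * ‖ξ‖ ^ 2)) (-α * (2 * inner ℝ (x - p.2.2) ξ + 2 * 0 * ‖ξ‖ ^ 2)) 0 := by
    have a := ((hasDerivAt_id (0:ℝ)).const_mul 2).mul_const (inner ℝ (x - p.2.2) ξ)
    have b := ((hasDerivAt_id (0:ℝ)).pow 2).mul_const (‖ξ‖ ^ 2)
    have := ((a.const_add (‖x - p.2.2‖ ^ 2)).add b).const_mul (-α)
    simpa using this
  have h2 : HasDerivAt (fun t : ℝ => α * (2 * inner ℝ (x - p.2.2) ξ + 2 * t * ‖ξ‖ ^ 2))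
      (α * (2 * ‖ξ‖ ^ 2)) 0 := by
    have a := ((((hasDerivAt_id (0:ℝ)).const_mul 2).mul_const (‖ξ‖ ^ 2)).const_add
      (2 * inner ℝ (x - p.2.2) ξ)).const_mul α
    simpa using a
  have := (h1.exp.mul h2).const_mul p.2.1
  refine this.congr_deriv ?_
  unfold kap; simp; ring

lemma isLocalMin_line {n : ℕ} {u : En n → ℝ} {x : En n} (h : IsLocalMin u x) (ξ : En n) :
    IsLocalMin (fun t : ℝ => u (x + t • ξ)) 0 := by
  have hc : Filter.Tendsto (fun t : ℝ => x + t • ξ) (𝓝 0) (𝓝 x) := by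
    have : Continuous (fun t : ℝ => x + t • ξ) := by fun_prop
    simpa using this.tendsto 0
  have := hc.eventually h
  simpa [IsLocalMin, IsMinFilter] using this

lemma touch {n : ℕ} (α : ℝ) (p : ℝ × ℝ × En n) (x : En n) (φ : En n → ℝ)
    (hφ : ContDiff ℝ 2 φ) (hm : IsLocalMin (fun x => Wb α p x - φ x) x) :
    gradient φ x = kap α p x • (x - p.2.2) ∧
    ∀ ξ, fderiv ℝ (fderiv ℝ φ) x ξ ξ ≤
      kap α p x * (‖ξ‖ ^ 2 - 2 * α * (inner ℝ (x - p.2.2) ξ) ^ 2) := by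
  have l0 : ∀ ξ : En n, ∀ t : ℝ, HasDerivAt (fun t : ℝ => x + t • ξ) ξ t := fun ξ t => by
    simpa using ((hasDerivAt_id t).smul_const ξ).const_add x
  have l1 : ∀ ξ : En n, ∀ t : ℝ, HasDerivAt (fun t : ℝ => φ (x + t • ξ))
      (fderiv ℝ φ (x + t • ξ) ξ) t := fun ξ t =>
    ((hφ.differentiable (by norm_num)) _).hasFDerivAt.comp_hasDerivAt t (l0 ξ t)
  have l2 : ∀ ξ : En n, HasDerivAt (fun t : ℝ => fderiv ℝ φ (x + t • ξ) ξ)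
      (fderiv ℝ (fderiv ℝ φ) x ξ ξ) 0 := fun ξ => by
    have hd : Differentiable ℝ (fderiv ℝ φ) :=
      (hφ.fderiv_right (m := 1) (by norm_num)).differentiable (by norm_num)
    have := (hd (x + (0:ℝ) • ξ)).hasFDerivAt.comp_hasDerivAt (0:ℝ) (l0 ξ 0)
    have := this.clm_apply (hasDerivAt_const (0:ℝ) ξ)
    simpa using this
  have k1 := fun ξ t => (Wb_d1 α p x ξ t).sub (l1 ξ t)
  constructor
  · refine ext_inner_right ℝ fun ξ => ?_
    have := (isLocalMin_line hm ξ).hasDerivAt_eq_zero (k1 ξ 0)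
    rw [inner_gradient_left, inner_smul_left]
    simp [dW] at this
    simp [kap]
    linarith
  · intro ξ
    have := second_deriv_nonneg (k1 ξ) ((Wb_d2 α p x ξ).sub (l2 ξ)) (isLocalMin_line hm ξ)
    linarith

lemma hess_symm {n : ℕ} (φ : En n → ℝ) (hφ : ContDiff ℝ 2 φ) (x : En n) :
    (hessianMatrix φ x).IsSymm := by
  have := (hφ.contDiffAt (x := x)).isSymmSndFDerivAt (by simp)
  ext i j
  simp [hessianMatrix, iteratedFDeriv_two_apply]
  exact this _ _

lemma hess_quad {n : ℕ} (φ : En n → ℝ) (x : En n) (ξ : Fin n → ℝ) :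
    ξ ⬝ᵥ (hessianMatrix φ x).mulVec ξ =
      fderiv ℝ (fderiv ℝ φ) x (WithLp.toLp 2 ξ) (WithLp.toLp 2 ξ) := by
  have e : (WithLp.toLp 2 ξ : En n) = ∑ i, ξ i • EuclideanSpace.single i (1:ℝ) := by
    ext j
    simp [Finset.sum_apply, Pi.single_apply]
  rw [e]
  simp only [map_sum, map_smul, sum_apply, smul_apply]
  simp [hessianMatrix, iteratedFDeriv_two_apply, dotProduct, Matrix.mulVec, Finset.mul_sum, mul_comm]
  rw [Finset.sum_comm]
  refine Finset.sum_congr rfl fun i _ => Finset.sum_congr rfl fun j _ => ?_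
  ring

lemma F_bound {n : ℕ} {lam Lam : ℝ} (hlam : 0 < lam) {F : Mat n → ℝ}
    (hF : UniformlyElliptic lam Lam F) (hF0 : F 0 = 0) {α : ℝ} (hα : 0 ≤ α)
    {k : ℝ} (hk : 0 ≤ k) (y : En n) (H : Mat n) (hs : H.IsSymm)
    (hH : ∀ ξ : Fin n → ℝ, ξ ⬝ᵥ H.mulVec ξ ≤
      k * (‖(WithLp.toLp 2 ξ : En n)‖ ^ 2 - 2 * α * (inner ℝ y (WithLp.toLp 2 ξ)) ^ 2)) :
    k * (2 * α * lam * ‖y‖ ^ 2 - Lam * n) ≤ F H := by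
  have hn2 : ∀ ξ : En n, ‖ξ‖ ^ 2 = ∑ i, ξ i ^ 2 := fun ξ => by
    simp [EuclideanSpace.norm_sq_eq]
  have sI : (k • (1 : Mat n)).IsSymm := by simp [Matrix.IsSymm]
  set B : Mat n := k • (1 : Mat n) - H with hB
  have sB : B.IsSymm := sI.sub hs
  have qB : ∀ ξ : Fin n → ℝ, ξ ⬝ᵥ B.mulVec ξ = k * ‖(WithLp.toLp 2 ξ : En n)‖ ^ 2 -
      ξ ⬝ᵥ H.mulVec ξ := fun ξ => by
    rw [hB, Matrix.sub_mulVec, dotProduct_sub, Matrix.smul_mulVec, Matrix.one_mulVec,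
      dotProduct_smul, hn2]
    simp [dotProduct, sq]
  have pB : B.PosSemidef := by
    refine Matrix.PosSemidef.of_dotProduct_mulVec_nonneg ?_ ?_
    · simpa [Matrix.IsHermitian, Matrix.conjTranspose_eq_transpose_of_trivial] using sB.eq
    · intro ξ
      have := hH ξ
      rw [star_trivial, qB]
      have : 0 ≤ k * (2 * α * (inner ℝ y (WithLp.toLp 2 ξ)) ^ 2) := by positivity
      linarith [hH ξ]
  have tB : k * (2 * α * ‖y‖ ^ 2) ≤ B.trace := by
    have : ∀ i, k * (2 * α * (y i) ^ 2) ≤ B i i := fun i => by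
      have h1 := qB (Pi.single i 1)
      have h2 := hH (Pi.single i 1)
      have h3 : (Pi.single i 1 : Fin n → ℝ) ⬝ᵥ B.mulVec (Pi.single i 1) = B i i := by simp
      have h4 : inner ℝ y (WithLp.toLp 2 (Pi.single i 1 : Fin n → ℝ)) = y i := by
        simp [PiLp.inner_apply]
      rw [h4] at h2
      rw [h3] at h1
      linarith
    calc _ = ∑ i, k * (2 * α * (y i) ^ 2) := by rw [hn2, Finset.mul_sum, Finset.mul_sum]
      _ ≤ _ := Finset.sum_le_sum fun i _ => this i
  have a1 := (hF.2 H B hs sB pB).1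
  have a2 := (hF.2 0 (k • 1) (by simp [Matrix.IsSymm]) sI (Matrix.PosSemidef.one.smul hk)).2
  have e : H + B = k • 1 := by simp [hB]
  rw [e] at a1
  rw [hF0, zero_add] at a2
  have e3 : (k • (1 : Mat n)).trace = k * n := by simp
  rw [e3] at a2
  nlinarith [mul_le_mul_of_nonneg_left tB hlam.le]

/-- Admissible parameters of upper barriers. -/
def Pset {n : ℕ} (Ω : Set (En n)) (r R α K0 : ℝ) (g : En n → ℝ) : Set (ℝ × ℝ × En n) :=
  {p | K0 ≤ p.2.1 ∧ (∀ x ∈ closure Ω, r ≤ ‖x - p.2.2‖ ∧ ‖x - p.2.2‖ ≤ R) ∧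
    ∀ z ∈ frontier Ω, g z ≤ Wb α p z}

lemma Pset_closed {n : ℕ} (Ω : Set (En n)) (r R α K0 : ℝ) (g : En n → ℝ) :
    IsClosed (Pset Ω r R α K0 g) := by
  have c : Continuous fun p : ℝ × ℝ × En n => p.2.2 := by fun_prop
  have e : Pset Ω r R α K0 g = {p | K0 ≤ p.2.1} ∩ ((⋂ x ∈ closure Ω, {p | r ≤ ‖x - p.2.2‖} ∩
      {p | ‖x - p.2.2‖ ≤ R}) ∩ ⋂ z ∈ frontier Ω, {p | g z ≤ Wb α p z}) := by
    ext p; simp [Pset]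
  rw [e]
  refine (isClosed_le (by fun_prop) (by fun_prop)).inter (IsClosed.inter ?_ ?_)
  · exact isClosed_biInter fun x _ => (isClosed_le (by fun_prop) (by fun_prop)).inter
      (isClosed_le (by fun_prop) (by fun_prop))
  · exact isClosed_biInter fun z _ => isClosed_le (by fun_prop) (Wb_cont2 α z)

lemma Pset_near {n : ℕ} {Ω : Set (En n)} (hΩb : Bornology.IsBounded Ω) {r R α K0 : ℝ}
    (hr : 0 < r) (hα : 0 < α)
    (hsph : ∀ y ∈ frontier Ω, ∃ x : En n,
      dist y x = r ∧ Metric.closedBall x r ∩ closure Ω = {y})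
    (hR : ∀ x ∈ closure Ω, ∀ y ∈ closure Ω, dist x y + r ≤ R)
    {g : En n → ℝ} (hg : ContinuousOn g (frontier Ω))
    {y : En n} (hy : y ∈ frontier Ω) {η : ℝ} (hη : 0 < η) :
    ∃ p ∈ Pset Ω r R α K0 g, Wb α p y ≤ g y + η := by
  obtain ⟨c, hc, hcb⟩ := hsph y hy
  have hcl : ∀ x ∈ closure Ω, r ≤ ‖x - c‖ := fun x hx => by
    by_contra h
    push Not at h
    have : x ∈ Metric.closedBall c r ∩ closure Ω := ⟨by
      rw [Metric.mem_closedBall, dist_eq_norm]; exact h.le, hx⟩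
    rw [hcb, Set.mem_singleton_iff] at this
    rw [this, ← dist_eq_norm, hc] at h
    exact lt_irrefl _ h
  have hfc : IsCompact (frontier Ω) :=
    (hΩb.isCompact_closure).of_isClosed_subset isClosed_frontier frontier_subset_closure
  -- the bad part of the boundary
  have hS : IsCompact (frontier Ω ∩ g ⁻¹' Set.Ici (g y + η)) :=
    hfc.of_isClosed_subset (hg.preimage_isClosed_of_isClosed isClosed_frontier isClosed_Ici)
      inter_subset_left
  let h : En n → ℝ := fun z => Real.exp (-α * r ^ 2) - Real.exp (-α * ‖z - c‖ ^ 2)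
  have hh : Continuous h := by fun_prop
  have hh0 : ∀ x ∈ closure Ω, 0 ≤ h x := fun x hx => by
    have := hcl x hx
    have : Real.exp (-α * ‖x - c‖ ^ 2) ≤ Real.exp (-α * r ^ 2) := by
      apply Real.exp_le_exp.2
      have : r ^ 2 ≤ ‖x - c‖ ^ 2 := by gcongr
      nlinarith
    simp only [h]; linarith
  have hpos : ∀ z ∈ frontier Ω ∩ g ⁻¹' Set.Ici (g y + η), 0 < h z := fun z hz => by
    have hzc := frontier_subset_closure hz.1
    have hne : z ≠ y := by
      rintro rfl
      have := hz.2
      simp at this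
      linarith
    have : r < ‖z - c‖ := by
      refine lt_of_le_of_ne (hcl z hzc) fun he => hne ?_
      have : z ∈ Metric.closedBall c r ∩ closure Ω := ⟨by
        rw [Metric.mem_closedBall, dist_eq_norm]; exact he.ge, hzc⟩
      rw [hcb] at this
      exact this
    have : Real.exp (-α * ‖z - c‖ ^ 2) < Real.exp (-α * r ^ 2) := by
      apply Real.exp_lt_exp.2
      have : r ^ 2 < ‖z - c‖ ^ 2 := by gcongr
      nlinarith
    simp only [h]; linarith
  obtain ⟨m, hm, hmS⟩ : ∃ m > 0, ∀ z ∈ frontier Ω ∩ g ⁻¹' Set.Ici (g y + η), m ≤ h z := by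
    rcases Set.eq_empty_or_nonempty (frontier Ω ∩ g ⁻¹' Set.Ici (g y + η)) with he | hne
    · exact ⟨1, one_pos, by simp [he]⟩
    · obtain ⟨z, hz, hzm⟩ := hS.exists_isMinOn hne hh.continuousOn
      exact ⟨h z, hpos z hz, fun x hx => hzm hx⟩
  obtain ⟨G, hG⟩ := hfc.exists_bound_of_continuousOn hg
  have hG' : ∀ z ∈ frontier Ω, |g z| ≤ G := hG
  have hG0 : 0 ≤ G := (abs_nonneg _).trans (hG' y hy)
  set K := max (max K0 0) (2 * G / m) with hK
  have hK0 : K0 ≤ K := (le_max_left _ _).trans (le_max_left _ _)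
  have hKp : 0 ≤ K := (le_max_right _ _).trans (le_max_left _ _)
  have hKm : 2 * G ≤ K * m := by
    rw [← div_le_iff₀ hm]; exact le_max_right _ _
  have hW : ∀ z, Wb α (g y + η + K * Real.exp (-α * r ^ 2), K, c) z = g y + η + K * h z := by
    intro z; simp only [Wb, h]; ring
  refine ⟨(g y + η + K * Real.exp (-α * r ^ 2), K, c), ⟨hK0, ?_, ?_⟩, ?_⟩
  · intro x hx
    refine ⟨hcl x hx, ?_⟩
    have h1 := hR x hx y (frontier_subset_closure hy)
    have h2 := dist_triangle x y c
    rw [← dist_eq_norm]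
    linarith
  · intro z hz
    rw [hW]
    by_cases hz2 : g y + η ≤ g z
    · have h1 := hmS z ⟨hz, hz2⟩
      have h2 := mul_le_mul_of_nonneg_left h1 hKp
      have h3 := abs_le.1 (hG' z hz)
      have h4 := abs_le.1 (hG' y hy)
      linarith
    · have := mul_nonneg hKp (hh0 z (frontier_subset_closure hz))
      linarith
  · rw [hW]
    have : h y = 0 := by simp only [h, ← dist_eq_norm, hc, sub_self]
    rw [this]; simp

lemma Pset_coercive {n : ℕ} {Ω : Set (En n)} (hΩo : IsOpen Ω) {r R α K0 : ℝ}
    (hr : 0 < r) (hα : 0 < α) (hK0 : 0 ≤ K0) {g : En n → ℝ} {p : ℝ × ℝ × En n}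
    (hp : p ∈ Pset Ω r R α K0 g) {x : En n} {δ : ℝ} (hδ : 0 < δ) (hx : Metric.ball x δ ⊆ Ω) :
    ∃ z ∈ frontier Ω, g z + p.2.1 * (Real.exp (-α * R ^ 2) * (α * δ ^ 2)) ≤ Wb α p x := by
  have hxΩ : x ∈ Ω := hx (Metric.mem_ball_self hδ)
  have hc : p.2.2 ∉ closure Ω := fun h => by
    have := (hp.2.1 _ h).1
    simp at this
    linarith
  have hseg : (segment ℝ x p.2.2 ∩ frontier Ω).Nonempty := by
    by_contra hne
    rw [Set.not_nonempty_iff_eq_empty] at hne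
    have hpre := (convex_segment (𝕜 := ℝ) x p.2.2).isPreconnected
    obtain ⟨w, -, hw1, hw2⟩ := hpre Ω (closure Ω)ᶜ hΩo isClosed_closure.isOpen_compl (by
      intro w hw
      by_cases h : w ∈ closure Ω
      · left
        by_contra h2
        have : w ∈ segment ℝ x p.2.2 ∩ frontier Ω := ⟨hw, by
          rw [frontier, hΩo.interior_eq]; exact ⟨h, h2⟩⟩
        rw [hne] at this
        exact this
      · exact Or.inr h) ⟨x, left_mem_segment _ _ _, hxΩ⟩ ⟨_, right_mem_segment _ _ _, hc⟩
    exact hw2 (subset_closure hw1)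
  obtain ⟨z, hz, hzf⟩ := hseg
  refine ⟨z, hzf, ?_⟩
  have hd := dist_add_dist_of_mem_segment hz
  have hzx : δ ≤ dist x z := by
    by_contra h
    push Not at h
    have : z ∈ Ω := hx (by rw [Metric.mem_ball, dist_comm]; exact h)
    rw [frontier, hΩo.interior_eq] at hzf
    exact hzf.2 this
  have h1 := hp.2.2 z hzf
  have h2 := (hp.2.1 x (subset_closure hxΩ)).2
  have hKp : 0 ≤ p.2.1 := hK0.trans hp.1
  rw [← dist_eq_norm] at h2
  simp only [Wb, ← dist_eq_norm] at h1 ⊢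
  set t := dist x p.2.2
  set u := dist z p.2.2
  have hu : 0 ≤ u := dist_nonneg
  have ht : 0 ≤ t := dist_nonneg
  have hd2 : δ ^ 2 ≤ t ^ 2 - u ^ 2 := by nlinarith
  have e1 : Real.exp (-α * R ^ 2) ≤ Real.exp (-α * t ^ 2) := by
    apply Real.exp_le_exp.2
    have : t ^ 2 ≤ R ^ 2 := by gcongr
    nlinarith
  have e2 : Real.exp (-α * u ^ 2) = Real.exp (-α * t ^ 2) * Real.exp (α * (t ^ 2 - u ^ 2)) := by
    rw [← Real.exp_add]; ring_nf
  have e3 : α * δ ^ 2 + 1 ≤ Real.exp (α * (t ^ 2 - u ^ 2)) := by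
    have := Real.add_one_le_exp (α * (t ^ 2 - u ^ 2))
    nlinarith
  have e4 : Real.exp (-α * R ^ 2) * (α * δ ^ 2) ≤
      Real.exp (-α * u ^ 2) - Real.exp (-α * t ^ 2) := by
    have : Real.exp (-α * R ^ 2) * (α * δ ^ 2) ≤ Real.exp (-α * t ^ 2) * (α * δ ^ 2) := by gcongr
    rw [e2]
    have := mul_le_mul_of_nonneg_left e3 (Real.exp_pos (-α * t ^ 2)).le
    linarith
  have := mul_le_mul_of_nonneg_left e4 hKp
  linarith

lemma Pset_compare {n : ℕ} {Ω : Set (En n)} (hΩo : IsOpen Ω)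
    (hΩb : Bornology.IsBounded Ω) {r R α K0 : ℝ}
    (hr : 0 < r) (hα : 0 < α) (hαr : (n : ℝ) < 2 * α * r ^ 2) (hK0 : 0 < K0) {g g' : En n → ℝ}
    {p p' : ℝ × ℝ × En n}
    (hp : p ∈ Pset Ω r R α K0 g) (hp' : p' ∈ Pset Ω r R α K0 g')
    (hgg : ∀ z ∈ frontier Ω, 0 ≤ g z + g' z) {x : En n} (hx : x ∈ closure Ω) :
    0 ≤ Wb α p x + Wb α p' x := by
  obtain ⟨m, hm, hmin⟩ := hΩb.isCompact_closure.exists_isMinOn ⟨x, hx⟩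
    (f := fun x => Wb α p x + Wb α p' x) ((Wb_cont1 α p).add (Wb_cont1 α p')).continuousOn
  have hmx : Wb α p m + Wb α p' m ≤ Wb α p x + Wb α p' x := hmin hx
  refine le_trans ?_ hmx
  by_cases hmΩ : m ∈ Ω
  · exfalso
    have hloc : IsLocalMin (fun x => Wb α p x + Wb α p' x) m := by
      filter_upwards [hΩo.mem_nhds hmΩ] with w hw using hmin (subset_closure hw)
    have key : ∀ q : ℝ × ℝ × En n, q.2.1 ≥ K0 → r ≤ ‖m - q.2.2‖ →
        ∑ i : Fin n, kap α q m * (‖(EuclideanSpace.single i (1:ℝ) : En n)‖ ^ 2 - 2 * α *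
          (inner ℝ (m - q.2.2) (EuclideanSpace.single i (1:ℝ))) ^ 2) < 0 := by
      intro q hq1 hq2
      have hk : 0 < kap α q m := by
        have : 0 < q.2.1 := hK0.trans_le hq1
        unfold kap; positivity
      have e : ‖m - q.2.2‖ ^ 2 = ∑ i, (m - q.2.2) i ^ 2 := by
        simp [EuclideanSpace.norm_sq_eq]
      rw [← Finset.mul_sum, Finset.sum_sub_distrib, ← Finset.mul_sum]
      have e2 : ∑ i : Fin n, (inner ℝ (m - q.2.2) (EuclideanSpace.single i (1:ℝ))) ^ 2
          = ‖m - q.2.2‖ ^ 2 := by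
        rw [e]
        refine Finset.sum_congr rfl fun i _ => ?_
        simp [EuclideanSpace.inner_single_right]
      rw [e2]
      simp only [PiLp.norm_single, norm_one, one_pow, Finset.sum_const,
        Finset.card_univ, Fintype.card_fin, nsmul_eq_mul, mul_one]
      apply mul_neg_of_pos_of_neg hk
      have : r ^ 2 ≤ ‖m - q.2.2‖ ^ 2 := by gcongr
      nlinarith
    have s : ∀ ξ : En n, 0 ≤ kap α p m * (‖ξ‖ ^ 2 - 2 * α * (inner ℝ (m - p.2.2) ξ) ^ 2) +
        kap α p' m * (‖ξ‖ ^ 2 - 2 * α * (inner ℝ (m - p'.2.2) ξ) ^ 2) := fun ξ =>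
      second_deriv_nonneg (fun t => (Wb_d1 α p m ξ t).add (Wb_d1 α p' m ξ t))
        ((Wb_d2 α p m ξ).add (Wb_d2 α p' m ξ)) (isLocalMin_line hloc ξ)
    have k1 := key p hp.1 (hp.2.1 m hm).1
    have k2 := key p' hp'.1 (hp'.2.1 m hm).1
    have k3 := Finset.sum_nonneg fun (i : Fin n) (_ : i ∈ Finset.univ) =>
      s (EuclideanSpace.single i (1:ℝ))
    rw [Finset.sum_add_distrib] at k3
    linarith
  · have hf : m ∈ frontier Ω := by rw [frontier, hΩo.interior_eq]; exact ⟨hm, hmΩ⟩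
    have := hp.2.2 m hf
    have := hp'.2.2 m hf
    have := hgg m hf
    linarith

lemma Pset_compact {n : ℕ} {Ω : Set (En n)} (hΩo : IsOpen Ω) {r R α K0 G : ℝ}
    (hr : 0 < r) (hα : 0 < α) (hK0 : 0 ≤ K0) {g : En n → ℝ}
    (hG : ∀ z ∈ frontier Ω, |g z| ≤ G) {p0 : ℝ × ℝ × En n}
    (hp0 : p0 ∈ Pset Ω r R α K0 g) {δ : ℝ} (hδ : 0 < δ) :
    ∃ Q ⊆ Pset Ω r R α K0 g, IsCompact Q ∧ ∀ x, Metric.ball x δ ⊆ Ω →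
      ∀ p ∈ Pset Ω r R α K0 g, ∃ p' ∈ Q, Wb α p' x ≤ Wb α p x := by
  by_cases hne : ∃ x, Metric.ball x δ ⊆ Ω
  swap
  · exact ⟨∅, by simp, isCompact_empty, fun x hx => absurd ⟨x, hx⟩ hne⟩
  obtain ⟨x1, hx1⟩ := hne
  have hx1Ω : x1 ∈ Ω := hx1 (Metric.mem_ball_self hδ)
  set θ := Real.exp (-α * R ^ 2) * (α * δ ^ 2) with hθ
  have hθp : 0 < θ := by positivity
  set K1 := (p0.1 + G) / θ with hK1
  set Q := Pset Ω r R α K0 g ∩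
    (Set.Icc (-G) (p0.1 + K1) ×ˢ (Set.Icc 0 K1 ×ˢ Metric.closedBall x1 R)) with hQ
  have hmem : ∀ x, Metric.ball x δ ⊆ Ω → ∀ p ∈ Pset Ω r R α K0 g, Wb α p x ≤ p0.1 → p ∈ Q := by
    intro x hx p hp hle
    obtain ⟨z, hz, hzle⟩ := Pset_coercive hΩo hr hα hK0 hp hδ hx
    have hgz := abs_le.1 (hG z hz)
    have hKp : 0 ≤ p.2.1 := hK0.trans hp.1
    have hKθ : 0 ≤ p.2.1 * θ := by positivity
    have hKK : p.2.1 ≤ K1 := by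
      rw [hK1, le_div_iff₀ hθp]; linarith
    have hexp : Real.exp (-α * ‖x - p.2.2‖ ^ 2) ≤ 1 := by
      rw [Real.exp_le_one_iff]
      have := mul_nonneg hα.le (sq_nonneg ‖x - p.2.2‖)
      linarith
    have h1 : p.2.1 * Real.exp (-α * ‖x - p.2.2‖ ^ 2) ≤ p.2.1 := mul_le_of_le_one_right hKp hexp
    have h2 : 0 ≤ p.2.1 * Real.exp (-α * ‖x - p.2.2‖ ^ 2) := by positivity
    have h3 : Wb α p x = p.1 - p.2.1 * Real.exp (-α * ‖x - p.2.2‖ ^ 2) := rfl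
    refine ⟨hp, ⟨by linarith, by linarith⟩, ⟨hKp, hKK⟩, ?_⟩
    rw [Metric.mem_closedBall, dist_comm, dist_eq_norm]
    exact (hp.2.1 x1 (subset_closure hx1Ω)).2
  refine ⟨Q, inter_subset_left, ?_, ?_⟩
  · exact ((isCompact_Icc.prod (isCompact_Icc.prod (isCompact_closedBall x1 R)))).inter_left
      (Pset_closed Ω r R α K0 g)
  · intro x hx p hp
    by_cases hle : Wb α p x ≤ p0.1
    · exact ⟨p, hmem x hx p hp hle, le_rfl⟩
    · have h0 : Wb α p0 x ≤ p0.1 := by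
        have hKp : 0 ≤ p0.2.1 := hK0.trans hp0.1
        have : 0 ≤ p0.2.1 * Real.exp (-α * ‖x - p0.2.2‖ ^ 2) := by positivity
        unfold Wb; linarith
      exact ⟨p0, hmem x hx p0 hp0 h0, by linarith⟩

lemma exists_barrier {n : ℕ} {Ω : Set (En n)} (hΩo : IsOpen Ω)
    (hΩb : Bornology.IsBounded Ω) {r R α K0 : ℝ}
    (hr : 0 < r) (hα : 0 < α) (hαr : (n : ℝ) < 2 * α * r ^ 2) (hK0 : 0 < K0)
    (hsph : ∀ y ∈ frontier Ω, ∃ x : En n,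
      dist y x = r ∧ Metric.closedBall x r ∩ closure Ω = {y})
    (hR : ∀ x ∈ closure Ω, ∀ y ∈ closure Ω, dist x y + r ≤ R)
    {g : En n → ℝ} (hg : ContinuousOn g (frontier Ω)) (hfne : (frontier Ω).Nonempty) :
    ∃ w : En n → ℝ, ContinuousOn w (closure Ω) ∧ (∀ x ∈ frontier Ω, w x = g x) ∧
      (∀ x ∈ Ω, ∃ p ∈ Pset Ω r R α K0 g, w x = Wb α p x ∧ ∀ y ∈ closure Ω, w y ≤ Wb α p y) := by
  have hfc : IsCompact (frontier Ω) :=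
    (hΩb.isCompact_closure).of_isClosed_subset isClosed_frontier frontier_subset_closure
  obtain ⟨G, hG⟩ := hfc.exists_bound_of_continuousOn hg
  have hG' : ∀ z ∈ frontier Ω, |g z| ≤ G := hG
  set P := Pset Ω r R α K0 g with hP
  obtain ⟨y0, hy0⟩ := hfne
  obtain ⟨p0, hp0, -⟩ := Pset_near (K0 := K0) hΩb hr hα hsph hR hg hy0 one_pos
  obtain ⟨p1, hp1, -⟩ := Pset_near (K0 := K0) hΩb hr hα hsph hR hg.neg hy0 one_pos
  have hneg : ∀ p ∈ P, ∀ p' ∈ Pset Ω r R α K0 (-g), ∀ x ∈ closure Ω,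
      -Wb α p' x ≤ Wb α p x := fun p hp p' hp' x hx => by
    have := Pset_compare hΩo hΩb hr hα hαr hK0 hp hp' (by simp) hx
    linarith
  set w : En n → ℝ := fun x => sInf ((fun p => Wb α p x) '' P) with hw
  have hbdd : ∀ x ∈ closure Ω, BddBelow ((fun p => Wb α p x) '' P) := fun x hx =>
    ⟨-Wb α p1 x, by rintro _ ⟨p, hp, rfl⟩; exact hneg p hp p1 hp1 x hx⟩
  have hle : ∀ p ∈ P, ∀ x ∈ closure Ω, w x ≤ Wb α p x := fun p hp x hx =>
    csInf_le (hbdd x hx) ⟨p, hp, rfl⟩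
  have hge : ∀ x, ∀ c, (∀ p ∈ P, c ≤ Wb α p x) → c ≤ w x := fun x c h =>
    le_csInf ⟨_, p0, hp0, rfl⟩ (by rintro _ ⟨p, hp, rfl⟩; exact h p hp)
  have hbd : ∀ x ∈ frontier Ω, w x = g x := fun x hx => by
    apply le_antisymm
    · refine le_of_forall_pos_le_add fun η hη => ?_
      obtain ⟨p, hp, hpx⟩ := Pset_near (K0 := K0) hΩb hr hα hsph hR hg hx hη
      exact (hle p hp x (frontier_subset_closure hx)).trans hpx
    · exact hge x _ fun p hp => hp.2.2 x hx
  have hatt : ∀ Q ⊆ P, IsCompact Q → ∀ x,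
      (∀ p ∈ P, ∃ p' ∈ Q, Wb α p' x ≤ Wb α p x) →
      ∃ p ∈ P, w x = Wb α p x ∧ w x = sInf ((fun p => Wb α p x) '' Q) := by
    intro Q hQP hQ x hx
    obtain ⟨q0, hq0, -⟩ := hx p0 hp0
    obtain ⟨q, hq, hqm⟩ := hQ.exists_isMinOn ⟨q0, hq0⟩ (Wb_cont2 α x).continuousOn
    have l1 : IsLeast ((fun p => Wb α p x) '' Q) (Wb α q x) :=
      ⟨⟨q, hq, rfl⟩, by rintro _ ⟨p, hp, rfl⟩; exact hqm hp⟩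
    have l2 : IsLeast ((fun p => Wb α p x) '' P) (Wb α q x) :=
      ⟨⟨q, hQP hq, rfl⟩, by
        rintro _ ⟨p, hp, rfl⟩
        obtain ⟨p', hp', h'⟩ := hx p hp
        exact (hqm hp').trans h'⟩
    exact ⟨q, hQP hq, l2.csInf_eq, l2.csInf_eq.trans l1.csInf_eq.symm⟩
  refine ⟨w, ?_, hbd, ?_⟩
  · intro x hx
    by_cases hxΩ : x ∈ Ω
    · obtain ⟨δ, hδ, hball⟩ := Metric.isOpen_iff.1 hΩo x hxΩ
      obtain ⟨Q, hQP, hQ, hQx⟩ := Pset_compact hΩo hr hα hK0.le hG' hp0 (half_pos hδ)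
      have hc : Continuous fun x => sInf ((fun p => Wb α p x) '' Q) :=
        hQ.continuous_sInf (f := fun x p => Wb α p x) (Wb_cont α)
      have he : w =ᶠ[𝓝 x] fun x => sInf ((fun p => Wb α p x) '' Q) := by
        filter_upwards [Metric.ball_mem_nhds x (half_pos hδ)] with u hu
        have hu' : Metric.ball u (δ / 2) ⊆ Ω := by
          refine (Metric.ball_subset_ball' ?_).trans hball
          rw [Metric.mem_ball] at hu
          linarith
        obtain ⟨p, -, -, h⟩ := hatt Q hQP hQ u (hQx u hu')
        exact h
      exact (hc.continuousAt.congr he.symm).continuousWithinAt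
    · have hf : x ∈ frontier Ω := by rw [frontier, hΩo.interior_eq]; exact ⟨hx, hxΩ⟩
      refine Metric.continuousWithinAt_iff'.2 fun η hη => ?_
      obtain ⟨p, hp, hpx⟩ := Pset_near (K0 := K0) hΩb hr hα hsph hR hg hf (half_pos hη)
      obtain ⟨p', hp', hpx'⟩ := Pset_near (K0 := K0) hΩb hr hα hsph hR hg.neg hf (half_pos hη)
      have c1 : ∀ᶠ u in 𝓝[closure Ω] x, Wb α p u < g x + η :=
        ((Wb_cont1 α p).tendsto x).eventually_lt_const (by linarith) |>.filter_mono inf_le_left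
      have c2 : ∀ᶠ u in 𝓝[closure Ω] x, Wb α p' u < - g x + η :=
        ((Wb_cont1 α p').tendsto x).eventually_lt_const (by simp at hpx'; linarith)
          |>.filter_mono inf_le_left
      filter_upwards [c1, c2, self_mem_nhdsWithin] with u h1 h2 hu
      rw [hbd x hf, Real.dist_eq, abs_lt]
      have h3 := hle p hp u hu
      have h4 := hge u _ fun q hq => hneg q hq p' hp' u hu
      constructor <;> linarith
  · intro x hx
    obtain ⟨δ, hδ, hball⟩ := Metric.isOpen_iff.1 hΩo x hx
    obtain ⟨Q, hQP, hQ, hQx⟩ := Pset_compact hΩo hr hα hK0.le hG' hp0 hδ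
    obtain ⟨p, hp, h, -⟩ := hatt Q hQP hQ x (hQx x hball)
    exact ⟨p, hp, h, hle p hp⟩

lemma chi_nonneg {n : ℕ} {ε : ℝ} {φε : En n → ℝ} (h : IsMollifier ε φε) (S : Set (En n))
    (x : En n) : 0 ≤ smoothedChi φε S x :=
  integral_nonneg fun y => mul_nonneg (h.2.1 y) (Set.indicator_nonneg (fun _ _ => zero_le_one) _)

lemma reg_alg {l ε pp pm q s c1 c2 a b T f : ℝ} (hell : 1 ≤ l) (hε0 : 0 < ε)
    (hc1 : 0 ≤ c1) (hc2 : 0 ≤ c2) (ha : 0 ≤ a) (hb : 0 ≤ b) (hpp : 0 ≤ pp) (hpm : 0 ≤ pm)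
    (hT : 0 ≤ T) (hf : f ≤ T) :
    0 ≤ (l ^ (ε + pp * c1 + pm * c2) + (ε + a * c1) * l ^ q + (ε + b * c2) * l ^ s) * T - f := by
  have hl : 0 ≤ l := zero_le_one.trans hell
  have h1 : 1 ≤ l ^ (ε + pp * c1 + pm * c2) := Real.one_le_rpow hell (by positivity)
  have h2 : 0 ≤ (ε + a * c1) * l ^ q := by positivity
  have h3 : 0 ≤ (ε + b * c2) * l ^ s := by positivity
  have h4 := mul_le_mul_of_nonneg_right
    (show 1 ≤ l ^ (ε + pp * c1 + pm * c2) + (ε + a * c1) * l ^ q + (ε + b * c2) * l ^ s by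
      linarith) hT
  linarith

lemma upper {n : ℕ} (hn : 2 ≤ n) (Ω : Set (En n)) (hΩo : IsOpen Ω) (hΩb : Bornology.IsBounded Ω)
    (hΩs : UnifExtSphere Ω)
    (lam Lam : ℝ) (hlam : 0 < lam) (hlL : lam ≤ Lam)
    (F : Mat n → ℝ) (hF : UniformlyElliptic lam Lam F) (hF0 : F 0 = 0)
    (pp pm q s : ℝ) (hpp : 0 ≤ pp) (hppq : pp ≤ q) (hpm : 0 ≤ pm) (hpms : pm ≤ s)
    (a b : En n → ℝ) (ha0 : ∀ x ∈ Ω, 0 ≤ a x) (hb0 : ∀ x ∈ Ω, 0 ≤ b x)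
    (f : En n → ℝ) (hfb : ∃ M, ∀ x ∈ Ω, |f x| ≤ M)
    (g : En n → ℝ) (hgc : ContinuousOn g (frontier Ω)) :
    ∃ whi : En n → ℝ,
      ContinuousOn whi (closure Ω) ∧ (∀ x ∈ frontier Ω, whi x = g x) ∧
      ∀ ε ∈ Set.Ioo (0:ℝ) 1, ∀ v : En n → ℝ,
        ∀ φε : En n → ℝ, IsMollifier ε φε →
          ViscSupOn Ω (regOp F ε pp pm q s a b v f φε) whi := by
  rcases Set.eq_empty_or_nonempty Ω with rfl | hne
  · exact ⟨g, by simp, by simp, fun ε _ v φε _ φ _ x hx => absurd hx (by simp)⟩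
  have : Nonempty (Fin n) := ⟨⟨0, by omega⟩⟩
  have : Nontrivial (En n) := inferInstance
  have hfne : (frontier Ω).Nonempty := nonempty_frontier_iff.2 ⟨hne, fun h => by
    rw [h] at hΩb
    exact NormedSpace.unbounded_univ ℝ (En n) hΩb⟩
  obtain ⟨r, hr, hsph⟩ := hΩs
  have hfc : IsCompact (frontier Ω) :=
    (hΩb.isCompact_closure).of_isClosed_subset isClosed_frontier frontier_subset_closure
  obtain ⟨G, hG⟩ := hfc.exists_bound_of_continuousOn hgc
  have hG' : ∀ z ∈ frontier Ω, |g z| ≤ G := hG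
  have hG0 : 0 ≤ G := by
    obtain ⟨y, hy⟩ := hfne; exact (abs_nonneg _).trans (hG' y hy)
  obtain ⟨M, hM⟩ := hfb
  have hM0 : 0 ≤ M := by
    obtain ⟨y, hy⟩ := hne; exact (abs_nonneg _).trans (hM y hy)
  set R := Metric.diam (closure Ω) + r with hRdef
  have hR : ∀ x ∈ closure Ω, ∀ y ∈ closure Ω, dist x y + r ≤ R := fun x hx y hy => by
    have := Metric.dist_le_diam_of_mem hΩb.closure hx hy
    linarith
  have hLam : 0 < Lam := hlam.trans_le hlL
  have hn0 : (0:ℝ) ≤ n := Nat.cast_nonneg n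
  set α := (Lam * n + 1) / (2 * lam * r ^ 2) with hαd
  have hα : 0 < α := by positivity
  have hα1 : 2 * α * lam * r ^ 2 = Lam * n + 1 := by rw [hαd]; field_simp
  have hαr : (n : ℝ) < 2 * α * r ^ 2 := by
    have : lam * n < lam * (2 * α * r ^ 2) := by nlinarith
    exact lt_of_mul_lt_mul_left this hlam.le
  set L := M + G + 1 / r with hL
  have hLp : 0 < L := by positivity
  set K0 := L / (2 * α * Real.exp (-α * R ^ 2)) with hK0d
  have hK0 : 0 < K0 := by positivity
  have hK1 : 2 * α * K0 * Real.exp (-α * R ^ 2) = L := by rw [hK0d]; field_simp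
  obtain ⟨w, hwc, hwb, hwp⟩ := exists_barrier hΩo hΩb hr hα hαr hK0 hsph hR hgc hfne
  refine ⟨w, hwc, hwb, ?_⟩
  rintro ε ⟨hε0, hε1⟩ v φε hmol φ hφ x hx hmin
  obtain ⟨p, hp, hpx, hpw⟩ := hwp x hx
  have hlm : IsLocalMin (fun x => Wb α p x - φ x) x := by
    have h1 : IsLocalMin (fun x => w x - φ x) x := hmin.isLocalMin (hΩo.mem_nhds hx)
    filter_upwards [h1, hΩo.mem_nhds hx] with u hu huΩ
    have := hpw u (subset_closure huΩ)
    linarith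
  obtain ⟨hgrad, hhess⟩ := touch α p x φ hφ hlm
  obtain ⟨hr1, hr2⟩ := hp.2.1 x (subset_closure hx)
  have hkap : L ≤ kap α p x := by
    rw [← hK1]
    unfold kap
    have e1 : Real.exp (-α * R ^ 2) ≤ Real.exp (-α * ‖x - p.2.2‖ ^ 2) := by
      apply Real.exp_le_exp.2
      have : ‖x - p.2.2‖ ^ 2 ≤ R ^ 2 := by gcongr
      nlinarith
    have h1 := hp.1
    have h2 : 0 ≤ p.2.1 := hK0.le.trans h1
    gcongr
  have hkp : 0 < kap α p x := hLp.trans_le hkap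
  have hFb := F_bound hlam hF hF0 hα.le hkp.le (x - p.2.2) (hessianMatrix φ x)
    (hess_symm φ hφ x) (fun ξ => by rw [hess_quad]; exact hhess _)
  have hF1 : L ≤ F (hessianMatrix φ x) := by
    have h2 : r ^ 2 ≤ ‖x - p.2.2‖ ^ 2 := by gcongr
    have h3 : 1 ≤ 2 * α * lam * ‖x - p.2.2‖ ^ 2 - Lam * n := by
      have : 2 * α * lam * r ^ 2 ≤ 2 * α * lam * ‖x - p.2.2‖ ^ 2 := by gcongr
      linarith
    nlinarith
  have hg1 : 1 ≤ ‖gradient φ x‖ := by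
    rw [hgrad, norm_smul, Real.norm_eq_abs, abs_of_pos hkp]
    have h1 : 1 / r ≤ kap α p x := by linarith
    calc (1:ℝ) = 1 / r * r := by field_simp
      _ ≤ _ := by gcongr
  have hwG : -G ≤ w x := by
    obtain ⟨δ, hδ, hball⟩ := Metric.isOpen_iff.1 hΩo x hx
    obtain ⟨z, hz, hzle⟩ := Pset_coercive hΩo hr hα hK0.le hp hδ hball
    have hgz := abs_le.1 (hG' z hz)
    have : 0 ≤ p.2.1 * (Real.exp (-α * R ^ 2) * (α * δ ^ 2)) := by
      have : 0 ≤ p.2.1 := hK0.le.trans hp.1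
      positivity
    rw [hpx]; linarith
  have hell : 1 ≤ ellReg ε (gradient φ x) := by
    unfold ellReg
    rw [Real.one_le_sqrt]
    nlinarith [sq_nonneg ε]
  have hc1 := chi_nonneg hmol {y | 0 < v y} x
  have hc2 := chi_nonneg hmol {y | v y < 0} x
  have ha := ha0 x hx
  have hb := hb0 x hx
  have hfx := abs_le.1 (hM x hx)
  have hsum : M ≤ ε * w x + F (hessianMatrix φ x) := by
    have h0 : 0 < 1 / r := by positivity
    have h1 : ε * (-G) ≤ ε * w x := mul_le_mul_of_nonneg_left hwG hε0.le
    have h2 : ε * G ≤ 1 * G := mul_le_mul_of_nonneg_right hε1.le hG0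
    linarith
  exact reg_alg hell hε0 hc1 hc2 ha hb hpp hpm (hM0.trans hsum) (hfx.2.trans hsum)

/-- existence of a continuous subsolution and supersolution of the
regularized equation attaining the boundary datum `g`, uniformly in `ε ∈ (0,1)` and
`v ∈ C(Ω̄)`. -/
theorem barriers_regularized
    {n : ℕ} (hn : 2 ≤ n) (Ω : Set (En n)) (hΩo : IsOpen Ω) (hΩb : Bornology.IsBounded Ω)
    (hΩs : UnifExtSphere Ω)
    (lam Lam : ℝ) (hlam : 0 < lam) (hlL : lam ≤ Lam)
    (F : Mat n → ℝ) (hF : UniformlyElliptic lam Lam F) (hF0 : F 0 = 0)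
    (pp pm q s : ℝ) (hpp : 0 ≤ pp) (hppq : pp ≤ q) (hpm : 0 ≤ pm) (hpms : pm ≤ s)
    (a b : En n → ℝ) (hac : ContinuousOn a Ω) (ha0 : ∀ x ∈ Ω, 0 ≤ a x)
    (hbc : ContinuousOn b Ω) (hb0 : ∀ x ∈ Ω, 0 ≤ b x)
    (f : En n → ℝ) (hfc : ContinuousOn f Ω) (hfb : ∃ M, ∀ x ∈ Ω, |f x| ≤ M)
    (g : En n → ℝ) (hgc : ContinuousOn g (frontier Ω)) :
    ∃ wlo whi : En n → ℝ,
      ContinuousOn wlo (closure Ω) ∧ ContinuousOn whi (closure Ω) ∧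
      (∀ x ∈ frontier Ω, wlo x = g x ∧ whi x = g x) ∧
      ∀ ε ∈ Set.Ioo (0:ℝ) 1, ∀ v : En n → ℝ, ContinuousOn v (closure Ω) →
        ∀ φε : En n → ℝ, IsMollifier ε φε →
          ViscSubOn Ω (regOp F ε pp pm q s a b v f φε) wlo ∧
          ViscSupOn Ω (regOp F ε pp pm q s a b v f φε) whi := by
  have hF' : UniformlyElliptic lam Lam (fun X => -F (-X)) := by
    refine ⟨(hF.1.comp continuous_neg).neg, fun A B hA hB hBp => ?_⟩
    have hs : (-A - B).IsSymm := hA.neg.sub hB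
    have := hF.2 (-A - B) B hs hB hBp
    rw [sub_add_cancel] at this
    beta_reduce
    rw [neg_add, ← sub_eq_add_neg]
    constructor <;> linarith [this.1, this.2]
  obtain ⟨whi, c1, b1, s1⟩ := upper hn Ω hΩo hΩb hΩs lam Lam hlam hlL F hF hF0 pp pm q s
    hpp hppq hpm hpms a b ha0 hb0 f hfb g hgc
  obtain ⟨w, c2, b2, s2⟩ := upper hn Ω hΩo hΩb hΩs lam Lam hlam hlL _ hF' (by simp [hF0]) pp pm q s
    hpp hppq hpm hpms a b ha0 hb0 (fun x => -f x) (by simpa using hfb) (fun x => -g x) hgc.neg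
  refine ⟨fun x => -w x, whi, c2.neg, c1, fun x hx => ⟨by simp [b2 x hx], b1 x hx⟩, ?_⟩
  intro ε hε v _ φε hm
  refine ⟨?_, s1 ε hε v φε hm⟩
  intro φ hφ x hx hmax
  have hmin : IsLocalMinOn (fun x => w x - (-φ) x) Ω x := by
    filter_upwards [hmax] with u hu
    simp at hu ⊢
    linarith
  have key := s2 ε hε v φε hm (-φ) hφ.neg x hx hmin
  have e1 : gradient (-φ) x = -gradient φ x := by simp [gradient, fderiv_neg]
  have e2 : hessianMatrix (-φ) x = -hessianMatrix φ x := by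
    ext i j
    simp [hessianMatrix, iteratedFDeriv_neg_apply]
  have e3 : ellReg ε (-gradient φ x) = ellReg ε (gradient φ x) := by simp [ellReg]
  rw [e1, e2] at key
  simp only [regOp, e3, neg_neg] at key ⊢
  linarith
end
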